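/- Let S be a faithfully flat R-algebra and M an R-module. Then M is in G̃(R) if and only if M ⊗_R S is in G̃(S). Consequently, G̃dim_R M = G̃dim_S (M ⊗_R S) for (FP)_∞ modules M. -/

import Mathlib

open CategoryTheory Opposite TensorProduct

universe u

namespace AB

/-- `M` is `(FP)ₙ`: there is an exact sequence `Fₙ → ⋯ → F₀ → M → 0`
with each `Fᵢ` finitely generated free.  Equivalently (the form used here),
`(FP)₀` means finitely generated, and `M` is `(FP)_{n+1}` iff there is a
surjection from a finitely generated free module whose kernel is `(FP)ₙ`. -/
def IsFP (R : Type u) [CommRing R] : ℕ → ModuleCat.{u} R → Prop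
  | 0, M => Module.Finite R M
  | n + 1, M => ∃ (k : ℕ) (f : (Fin k → R) →ₗ[R] M), Function.Surjective f ∧
      IsFP R n (ModuleCat.of R (LinearMap.ker f))

/-- `M` is `(FP)_∞`. -/
def IsFPInf (R : Type u) [CommRing R] (M : ModuleCat.{u} R) : Prop := ∀ n, IsFP R n M

/-- `Ext^i_R(M, N)` as a type. -/
noncomputable abbrev ext (R : Type u) [CommRing R] (M N : ModuleCat.{u} R) (i : ℕ) :=
  ((Ext R (ModuleCat.{u} R) i).obj (op M)).obj N

/-- `Ext^i_R(M, N) = 0`. -/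
def extZero (R : Type u) [CommRing R] (M N : ModuleCat.{u} R) (i : ℕ) : Prop :=
  Subsingleton (ext R M N i)

/-- membership in the G-class `G(R)`. -/
def MemG (R : Type u) [CommRing R] (M : ModuleCat.{u} R) : Prop :=
  Module.Finite R M ∧ Module.IsReflexive R M ∧
    (∀ i > 0, extZero R M (ModuleCat.of R R) i) ∧
    (∀ i > 0, extZero R (ModuleCat.of R (Module.Dual R M)) (ModuleCat.of R R) i)

/-- membership in the restricted G-class `G̃(R)`. -/
def MemGtilde (R : Type u) [CommRing R] (M : ModuleCat.{u} R) : Prop :=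
  MemG R M ∧ IsFPInf R M ∧ IsFPInf R (ModuleCat.of R (Module.Dual R M))

/-- `Gdim_R M ≤ n`. -/
def GDimLe (R : Type u) [CommRing R] : ℕ → ModuleCat.{u} R → Prop
  | 0, M => MemG R M
  | n + 1, M => ∃ (G : ModuleCat.{u} R) (f : G →ₗ[R] M), MemG R G ∧ Function.Surjective f ∧
      GDimLe R n (ModuleCat.of R (LinearMap.ker f))

/-- `G̃dim_R M ≤ n`. -/
def GtildeDimLe (R : Type u) [CommRing R] : ℕ → ModuleCat.{u} R → Prop
  | 0, M => MemGtilde R M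
  | n + 1, M => ∃ (G : ModuleCat.{u} R) (f : G →ₗ[R] M), MemGtilde R G ∧ Function.Surjective f ∧
      GtildeDimLe R n (ModuleCat.of R (LinearMap.ker f))

/-- `pd_R M ≤ n`. -/
def ProjDimLe (R : Type u) [CommRing R] : ℕ → ModuleCat.{u} R → Prop
  | 0, M => Module.Projective R M
  | n + 1, M => ∃ (P : ModuleCat.{u} R) (f : P →ₗ[R] M), Module.Projective R P ∧
      Function.Surjective f ∧ ProjDimLe R n (ModuleCat.of R (LinearMap.ker f))

/-- The G-dimension of `M`, as an element of `ℕ∞` (`⊤` meaning `Gdim` is infinite/undefined). -/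
noncomputable def GDim (R : Type u) [CommRing R] (M : ModuleCat.{u} R) : ℕ∞ :=
  sInf {n : ℕ∞ | ∃ m : ℕ, n = m ∧ GDimLe R m M}

/-- The restricted G-dimension of `M`, as an element of `ℕ∞`. -/
noncomputable def GtildeDim (R : Type u) [CommRing R] (M : ModuleCat.{u} R) : ℕ∞ :=
  sInf {n : ℕ∞ | ∃ m : ℕ, n = m ∧ GtildeDimLe R m M}

/-- The projective dimension of `M`, as an element of `ℕ∞`. -/
noncomputable def ProjDim (R : Type u) [CommRing R] (M : ModuleCat.{u} R) : ℕ∞ :=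
  sInf {n : ℕ∞ | ∃ m : ℕ, n = m ∧ ProjDimLe R m M}

/-- The classical depth of `N` with respect to the ideal `I`: the supremum of the
lengths of regular sequences on `N` contained in `I`. -/
noncomputable def cdepth (S : Type u) [CommRing S] (I : Ideal S) (N : Type u)
    [AddCommGroup N] [Module S N] : ℕ∞ :=
  ⨆ rs : {l : List S // (∀ r ∈ l, r ∈ I) ∧ RingTheory.Sequence.IsRegular N l},
    (rs.1.length : ℕ∞)

/-- A bundled faithfully flat (commutative) algebra extension of `R`. -/
structure FFExt (R : Type u) [CommRing R] where
  S : Type u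
  [ring : CommRing S]
  [alg : Algebra R S]
  faithfullyFlat : Module.FaithfullyFlat R S

attribute [instance] FFExt.ring FFExt.alg

/-- The depth of a module `M` over a quasi-local ring `R`: the supremum, over all
faithfully flat extensions `S` of `R`, of the classical depth of `M ⊗_R S` with
respect to `mS`. -/
noncomputable def depth (R : Type u) [CommRing R] [IsLocalRing R] (M : Type u)
    [AddCommGroup M] [Module R M] : ℕ∞ :=
  ⨆ E : FFExt R,
    cdepth E.S (Ideal.map (algebraMap R E.S) (IsLocalRing.maximalIdeal R))
      (TensorProduct R E.S M)

section FP

variable {R : Type u} [CommRing R]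
variable {A B C M N : Type u} [AddCommGroup A] [AddCommGroup B] [AddCommGroup C]
  [AddCommGroup M] [AddCommGroup N] [Module R A] [Module R B] [Module R C] [Module R M]
  [Module R N]

/-- In a left exact sequence the first term is the kernel of the second map. -/
noncomputable def equivKerOfExact {f : A →ₗ[R] B} {g : B →ₗ[R] C}
    (hf : Function.Injective f) (hfg : Function.Exact f g) : A ≃ₗ[R] LinearMap.ker g :=
  (LinearEquiv.ofInjective f hf).trans (LinearEquiv.ofEq _ _ hfg.linearMap_ker_eq.symm)

lemma IsFP.congr {n : ℕ} (e : M ≃ₗ[R] N) (h : IsFP R n (ModuleCat.of R M)) :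
    IsFP R n (ModuleCat.of R N) := by
  cases n with
  | zero =>
    have : Module.Finite R M := h
    exact Module.Finite.equiv e
  | succ n =>
    obtain ⟨k, f, hf, hk⟩ := h
    refine ⟨k, e.toLinearMap ∘ₗ f, e.surjective.comp hf, ?_⟩
    rw [LinearEquiv.ker_comp]
    exact hk

lemma IsFP.of_succ {n : ℕ} (h : IsFP R (n + 1) (ModuleCat.of R M)) :
    IsFP R n (ModuleCat.of R M) := by
  induction n generalizing M with
  | zero =>
    obtain ⟨k, f, hf, -⟩ := h
    exact Module.Finite.of_surjective f hf
  | succ n ih =>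
    obtain ⟨k, f, hf, hk⟩ := h
    exact ⟨k, f, hf, ih hk⟩

lemma IsFP.finite {n : ℕ} (h : IsFP R n (ModuleCat.of R M)) : Module.Finite R M := by
  induction n with
  | zero => exact h
  | succ n ih => exact ih h.of_succ

lemma IsFP.of_subsingleton (n : ℕ) [Subsingleton M] : IsFP R n (ModuleCat.of R M) := by
  induction n generalizing M with
  | zero => exact (inferInstance : Module.Finite R M)
  | succ n ih => exact ⟨0, 0, fun x => ⟨0, Subsingleton.elim _ _⟩, ih⟩

lemma IsFP.pi (n k : ℕ) : IsFP R n (ModuleCat.of R (Fin k → R)) := by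
  cases n with
  | zero => exact (inferInstance : Module.Finite R (Fin k → R))
  | succ n =>
    refine ⟨k, LinearMap.id, Function.surjective_id, ?_⟩
    rw [LinearMap.ker_id]
    exact IsFP.of_subsingleton n

/-- The class of `(FP)ₙ` modules is closed under extensions. -/
lemma IsFP.extension {n : ℕ} {f : A →ₗ[R] B} {g : B →ₗ[R] C} (hf : Function.Injective f)
    (hfg : Function.Exact f g) (hg : Function.Surjective g)
    (hA : IsFP R n (ModuleCat.of R A)) (hC : IsFP R n (ModuleCat.of R C)) :
    IsFP R n (ModuleCat.of R B) := by
  induction n generalizing A B C with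
  | zero =>
    have : Module.Finite R A := hA
    have : Module.Finite R C := hC
    exact Module.Finite.of_exact hfg hg
  | succ n ih =>
    obtain ⟨a, p, hp, hpk⟩ := hA
    obtain ⟨c, q, hq, hqk⟩ := hC
    obtain ⟨q', hq'⟩ := Module.projective_lifting_property g q hg
    replace hq' : ∀ y, g (q' y) = q y := fun y => LinearMap.congr_fun hq' y
    let h : (Fin a → R) × (Fin c → R) →ₗ[R] B := (f ∘ₗ p).coprod q'
    have hh : ∀ x y, h (x, y) = f (p x) + q' y := fun x y => by simp [h]
    have hgf : ∀ x, g (f x) = 0 := fun x => hfg.apply_apply_eq_zero x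
    have hsurj : Function.Surjective h := fun b => by
      obtain ⟨y, hy⟩ := hq (g b)
      obtain ⟨x', hx'⟩ := (hfg (b - q' y)).1 (by rw [map_sub, hq', hy, sub_self])
      obtain ⟨x, rfl⟩ := hp x'
      exact ⟨(x, y), by rw [hh, hx']; abel⟩
    let e : (Fin (a + c) → R) ≃ₗ[R] (Fin a → R) × (Fin c → R) :=
      (LinearEquiv.funCongrLeft R R finSumFinEquiv).trans
        (LinearEquiv.sumArrowLequivProdArrow (Fin a) (Fin c) R R)
    let i : LinearMap.ker p →ₗ[R] LinearMap.ker h :=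
      (LinearMap.inl R (Fin a → R) (Fin c → R)).restrict fun x hx => by
        simp only [LinearMap.mem_ker] at hx ⊢
        simp [hh, hx]
    let j : LinearMap.ker h →ₗ[R] LinearMap.ker q :=
      (LinearMap.snd R (Fin a → R) (Fin c → R)).restrict fun x hx => by
        obtain ⟨x, y⟩ := x
        simp only [LinearMap.mem_ker, hh] at hx ⊢
        simpa [hgf, hq'] using congrArg g hx
    have key : IsFP R n (ModuleCat.of R (LinearMap.ker h)) := by
      refine ih (f := i) (g := j) ?_ ?_ ?_ hpk hqk
      · intro x y hxy
        ext1
        exact congrArg (fun z => z.1.1) hxy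
      · rintro ⟨⟨x, y⟩, hxy⟩
        constructor
        · intro hy
          obtain rfl : y = 0 := congrArg Subtype.val hy
          refine ⟨⟨x, ?_⟩, rfl⟩
          simp only [LinearMap.mem_ker, hh, map_zero, add_zero] at hxy ⊢
          exact hf (by rw [hxy, map_zero])
        · rintro ⟨z, hz⟩
          rw [← hz]
          rfl
      · rintro ⟨y, hy⟩
        rw [LinearMap.mem_ker] at hy
        obtain ⟨x', hx'⟩ := (hfg (q' y)).1 (by rw [hq', hy])
        obtain ⟨x, rfl⟩ := hp x'
        exact ⟨⟨(-x, y), by simp [hh, hx']⟩, rfl⟩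
    refine ⟨a + c, h ∘ₗ e.toLinearMap, hsurj.comp e.surjective, ?_⟩
    rw [LinearMap.ker_comp]
    exact key.congr (e.submoduleMap _ |>.trans (LinearEquiv.ofEq _ _
      (Submodule.map_comap_eq_of_surjective e.surjective _))).symm

lemma IsFP.cokernel {n : ℕ} {f : A →ₗ[R] B} {g : B →ₗ[R] C} (hf : Function.Injective f)
    (hfg : Function.Exact f g) (hg : Function.Surjective g)
    (hA : IsFP R n (ModuleCat.of R A)) (hB : IsFP R (n + 1) (ModuleCat.of R B)) :
    IsFP R (n + 1) (ModuleCat.of R C) := by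
  obtain ⟨k, p, hp, hpk⟩ := hB
  refine ⟨k, g ∘ₗ p, hg.comp hp, ?_⟩
  have hker := hA.congr (equivKerOfExact hf hfg)
  let i : LinearMap.ker p →ₗ[R] LinearMap.ker (g ∘ₗ p) :=
    Submodule.inclusion (LinearMap.ker_le_ker_comp p g)
  let j : LinearMap.ker (g ∘ₗ p) →ₗ[R] LinearMap.ker g := p.restrict fun x hx => hx
  refine IsFP.extension (f := i) (g := j) (Submodule.inclusion_injective _) ?_ ?_ hpk hker
  · rintro ⟨x, hx⟩
    constructor
    · intro h
      exact ⟨⟨x, congrArg Subtype.val h⟩, rfl⟩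
    · rintro ⟨z, hz⟩
      rw [← hz]
      exact Subtype.ext z.2
  · rintro ⟨b, hb⟩
    obtain ⟨x, rfl⟩ := hp b
    exact ⟨⟨x, hb⟩, rfl⟩

lemma IsFP.of_projection {n : ℕ} {k : ℕ}
    (h : IsFP R n (ModuleCat.of R (A × (Fin k → R)))) : IsFP R n (ModuleCat.of R A) := by
  cases n with
  | zero =>
    have := h.finite
    exact Module.Finite.of_surjective (LinearMap.fst R A (Fin k → R)) LinearMap.fst_surjective
  | succ n =>
    exact IsFP.cokernel LinearMap.inr_injective Function.Exact.inr_fst LinearMap.fst_surjective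
      (IsFP.pi n k) h

lemma IsFP.kernel {n : ℕ} {f : A →ₗ[R] B} {g : B →ₗ[R] C} (hf : Function.Injective f)
    (hfg : Function.Exact f g) (hg : Function.Surjective g)
    (hB : IsFP R n (ModuleCat.of R B)) (hC : IsFP R (n + 1) (ModuleCat.of R C)) :
    IsFP R n (ModuleCat.of R A) := by
  obtain ⟨k, p, hp, hpk⟩ := hC
  obtain ⟨σ, hσ⟩ := Module.projective_lifting_property g p hg
  replace hσ : ∀ y, g (σ y) = p y := fun y => LinearMap.congr_fun hσ y
  have hgf : ∀ x, g (f x) = 0 := fun x => hfg.apply_apply_eq_zero x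
  let s : A × (Fin k → R) →ₗ[R] B := f.coprod σ
  have hs : ∀ a x, s (a, x) = f a + σ x := fun a x => by simp [s]
  let j : LinearMap.ker s →ₗ[R] LinearMap.ker p :=
    (LinearMap.snd R A (Fin k → R)).restrict fun x hx => by
      obtain ⟨x, y⟩ := x
      simp only [LinearMap.mem_ker, hs] at hx ⊢
      simpa [hgf, hσ] using congrArg g hx
  have hj : Function.Bijective j := by
    constructor
    · rw [injective_iff_map_eq_zero]
      rintro ⟨⟨a, x⟩, hx⟩ h
      obtain rfl : x = 0 := congrArg Subtype.val h
      simp only [LinearMap.mem_ker, hs, map_zero, add_zero] at hx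
      obtain rfl : a = 0 := hf (by rw [hx, map_zero])
      rfl
    · rintro ⟨x, hx⟩
      rw [LinearMap.mem_ker] at hx
      obtain ⟨a, ha⟩ := (hfg (σ x)).1 (by rw [hσ, hx])
      exact ⟨⟨(-a, x), by simp [hs, ha]⟩, rfl⟩
  refine IsFP.of_projection (k := k) (IsFP.extension (f := (LinearMap.ker s).subtype) (g := s)
    (Submodule.subtype_injective _) (LinearMap.exact_subtype_ker_map s) ?_
    (hpk.congr (LinearEquiv.ofBijective j hj).symm) hB)
  intro b
  obtain ⟨x, hx⟩ := hp (g b)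
  obtain ⟨a, ha⟩ := (hfg (b - σ x)).1 (by rw [map_sub, hσ, hx, sub_self])
  exact ⟨(a, x), by rw [hs, ha]; abel⟩

lemma IsFP.finitePresentation (h : IsFP R 1 (ModuleCat.of R M)) :
    Module.FinitePresentation R M := by
  obtain ⟨k, f, hf, hk⟩ := h
  exact Module.finitePresentation_of_surjective f hf (Module.Finite.iff_fg.1 hk)

lemma IsFPInf.congr (e : M ≃ₗ[R] N) (h : IsFPInf R (ModuleCat.of R M)) :
    IsFPInf R (ModuleCat.of R N) :=
  fun n => (h n).congr e

lemma IsFPInf.finitePresentation (h : IsFPInf R (ModuleCat.of R M)) :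
    Module.FinitePresentation R M :=
  (h 1).finitePresentation

/-- An `(FP)_∞` module is the quotient of a finite free module by an `(FP)_∞` submodule. -/
lemma IsFPInf.exists_surjective (h : IsFPInf R (ModuleCat.of R M)) :
    ∃ (k : ℕ) (f : (Fin k → R) →ₗ[R] M), Function.Surjective f ∧
      IsFPInf R (ModuleCat.of R (LinearMap.ker f)) := by
  obtain ⟨k, f, hf, -⟩ := h 1
  exact ⟨k, f, hf, fun n => IsFP.kernel (Submodule.subtype_injective _)
    (LinearMap.exact_subtype_ker_map f) hf (IsFP.pi n k) (h (n + 1))⟩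

end FP

section FPBaseChange

variable {R : Type u} (S : Type u) [CommRing R] [CommRing S] [Algebra R S]
variable {A B C M : Type u} [AddCommGroup A] [AddCommGroup B] [AddCommGroup C]
  [AddCommGroup M] [Module R A] [Module R B] [Module R C] [Module R M]

lemma baseChange_shortExact [Module.Flat R S] {f : A →ₗ[R] B} {g : B →ₗ[R] C}
    (hf : Function.Injective f) (hfg : Function.Exact f g) (hg : Function.Surjective g) :
    Function.Injective (f.baseChange S) ∧ Function.Exact (f.baseChange S) (g.baseChange S) ∧
      Function.Surjective (g.baseChange S) :=
  ⟨Module.Flat.lTensor_preserves_injective_linearMap f hf, lTensor_exact S hfg hg,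
    LinearMap.lTensor_surjective S hg⟩

lemma IsFP.baseChange_pi (n k : ℕ) : IsFP S n (ModuleCat.of S (S ⊗[R] (Fin k → R))) :=
  (IsFP.pi n k).congr (TensorProduct.piScalarRight R S S (Fin k)).symm

lemma IsFP.baseChange [Module.Flat R S] {n : ℕ} (h : IsFP R n (ModuleCat.of R M)) :
    IsFP S n (ModuleCat.of S (S ⊗[R] M)) := by
  induction n generalizing M with
  | zero =>
    have := h.finite
    exact (inferInstance : Module.Finite S (S ⊗[R] M))
  | succ n ih =>
    obtain ⟨k, f, hf, hk⟩ := h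
    obtain ⟨h₁, h₂, h₃⟩ := baseChange_shortExact S (Submodule.subtype_injective _)
      (LinearMap.exact_subtype_ker_map f) hf
    exact IsFP.cokernel h₁ h₂ h₃ (ih hk) (IsFP.baseChange_pi S (n + 1) k)

lemma IsFP.of_baseChange [Module.FaithfullyFlat R S] {n : ℕ}
    (h : IsFP S n (ModuleCat.of S (S ⊗[R] M))) : IsFP R n (ModuleCat.of R M) := by
  have := h.finite
  have hM : Module.Finite R M := Module.Finite.of_finite_tensorProduct_of_faithfullyFlat S
  induction n generalizing M with
  | zero => exact hM
  | succ n ih =>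
    obtain ⟨k, f, hf⟩ := Module.Finite.exists_fin' R M
    obtain ⟨h₁, h₂, h₃⟩ := baseChange_shortExact S (Submodule.subtype_injective _)
      (LinearMap.exact_subtype_ker_map f) hf
    have hK := IsFP.kernel h₁ h₂ h₃ (IsFP.baseChange_pi S n k) h
    have := hK.finite
    exact ⟨k, f, hf, ih hK this (Module.Finite.of_finite_tensorProduct_of_faithfullyFlat S)⟩

lemma isFPInf_baseChange_iff [Module.FaithfullyFlat R S] :
    IsFPInf S (ModuleCat.of S (S ⊗[R] M)) ↔ IsFPInf R (ModuleCat.of R M) :=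
  ⟨fun h n => (h n).of_baseChange S, fun h n => (h n).baseChange S⟩

end FPBaseChange

section ExtVanishing

variable {R : Type u} [CommRing R]

/-- A computation of the vanishing of `Ext` from a projective resolution. -/
lemma extZero_succ_iff_of_projectiveResolution {X : ModuleCat.{u} R}
    (P : ProjectiveResolution X) (Y : ModuleCat.{u} R) (n : ℕ) :
    extZero R X Y (n + 1) ↔ ∀ f : P.complex.X (n + 1) ⟶ Y,
      P.complex.d (n + 2) (n + 1) ≫ f = 0 → ∃ g, P.complex.d (n + 1) n ≫ g = f := by
  have e := P.isoExt (R := R) (n + 1) Y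
  have h₁ : extZero R X Y (n + 1) ↔
      Limits.IsZero ((P.complex.linearYonedaObj R Y).homology (n + 1)) := by
    rw [← e.isZero_iff, ModuleCat.isZero_iff_subsingleton]
    rfl
  rw [h₁, ← HomologicalComplex.exactAt_iff_isZero_homology,
    HomologicalComplex.exactAt_iff' _ n (n + 1) (n + 2) (by simp) (by simp),
    ShortComplex.moduleCat_exact_iff]
  rfl

lemma subsingleton_ext_succ_iff_of_projectiveResolution {X : ModuleCat.{u} R}
    (P : ProjectiveResolution X) (Y : ModuleCat.{u} R) (n : ℕ) :
    Subsingleton (Abelian.Ext X Y (n + 1)) ↔ ∀ f : P.complex.X (n + 1) ⟶ Y,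
      P.complex.d (n + 2) (n + 1) ≫ f = 0 → ∃ g, P.complex.d (n + 1) n ≫ g = f := by
  constructor
  · intro _ f hf
    exact (P.extMk_eq_zero_iff f (n + 2) rfl hf n rfl).1 (Subsingleton.elim _ _)
  · intro h
    refine subsingleton_of_forall_eq 0 fun α => ?_
    obtain ⟨f, hf, rfl⟩ := P.extMk_surjective α (n + 2) rfl
    exact (P.extMk_eq_zero_iff f (n + 2) rfl hf n rfl).2 (h f hf)

lemma extZero_succ_iff (X Y : ModuleCat.{u} R) (n : ℕ) :
    extZero R X Y (n + 1) ↔ Subsingleton (Abelian.Ext X Y (n + 1)) := by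
  rw [extZero_succ_iff_of_projectiveResolution (projectiveResolution X),
    subsingleton_ext_succ_iff_of_projectiveResolution (projectiveResolution X)]

variable {A B C M N : Type u} [AddCommGroup A] [AddCommGroup B] [AddCommGroup C]
  [AddCommGroup M] [AddCommGroup N] [Module R A] [Module R B] [Module R C] [Module R M]
  [Module R N]

lemma extZero_of_projective [Module.Projective R M] (Y : ModuleCat.{u} R) (n : ℕ) :
    extZero R (ModuleCat.of R M) Y (n + 1) :=
  (extZero_succ_iff _ _ _).2 (Abelian.Ext.subsingleton_of_projective _ _ _)

/-- The short exact sequence of bundled modules attached to an exact pair of maps. -/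
lemma shortExact_of_exact {f : A →ₗ[R] B} {g : B →ₗ[R] C} (hf : Function.Injective f)
    (hfg : Function.Exact f g) (hg : Function.Surjective g) :
    (ShortComplex.mk (ModuleCat.ofHom f) (ModuleCat.ofHom g)
      (by ext x; exact hfg.apply_apply_eq_zero x)).ShortExact :=
  ModuleCat.shortComplex_shortExact _ hfg hf hg

variable {f : A →ₗ[R] B} {g : B →ₗ[R] C} (hf : Function.Injective f)
  (hfg : Function.Exact f g) (hg : Function.Surjective g) (Y : ModuleCat.{u} R) (n : ℕ)

include hf hfg hg

lemma extZero_left (hB : extZero R (ModuleCat.of R B) Y (n + 1))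
    (hC : extZero R (ModuleCat.of R C) Y (n + 2)) :
    extZero R (ModuleCat.of R A) Y (n + 1) := by
  rw [extZero_succ_iff] at hB hC ⊢
  refine subsingleton_of_forall_eq 0 fun x => ?_
  obtain ⟨y, rfl⟩ := Abelian.Ext.contravariant_sequence_exact₁ (shortExact_of_exact hf hfg hg) Y x
    (n₁ := n + 2) (by lia) (hC.elim _ _)
  rw [hB.elim y 0, Abelian.Ext.comp_zero]

lemma extZero_middle (hA : extZero R (ModuleCat.of R A) Y (n + 1))
    (hC : extZero R (ModuleCat.of R C) Y (n + 1)) :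
    extZero R (ModuleCat.of R B) Y (n + 1) := by
  rw [extZero_succ_iff] at hA hC ⊢
  refine subsingleton_of_forall_eq 0 fun x => ?_
  obtain ⟨y, rfl⟩ := Abelian.Ext.contravariant_sequence_exact₂ (shortExact_of_exact hf hfg hg) Y x
    (hA.elim _ _)
  rw [hC.elim y 0, Abelian.Ext.comp_zero]

lemma extZero_right (hA : extZero R (ModuleCat.of R A) Y (n + 1))
    (hB : extZero R (ModuleCat.of R B) Y (n + 2)) :
    extZero R (ModuleCat.of R C) Y (n + 2) := by
  rw [extZero_succ_iff] at hA hB ⊢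
  refine subsingleton_of_forall_eq 0 fun x => ?_
  obtain ⟨y, rfl⟩ := Abelian.Ext.contravariant_sequence_exact₃ (shortExact_of_exact hf hfg hg) Y x
    (hB.elim _ _) (n₀ := n + 1) (by lia)
  rw [hA.elim y 0, Abelian.Ext.comp_zero]

lemma dualMap_surjective_of_extZero
    (hC : extZero R (ModuleCat.of R C) (ModuleCat.of R R) 1) :
    Function.Surjective f.dualMap := by
  intro φ
  rw [extZero_succ_iff] at hC
  obtain ⟨y, hy⟩ := Abelian.Ext.contravariant_sequence_exact₁ (shortExact_of_exact hf hfg hg)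
    (ModuleCat.of R R) (Abelian.Ext.mk₀ (ModuleCat.ofHom φ)) (n₁ := 1) rfl (hC.elim _ _)
  obtain ⟨ψ, rfl⟩ := Abelian.Ext.homEquiv₀.symm.surjective y
  replace hy : (Abelian.Ext.mk₀ _).comp (Abelian.Ext.mk₀ ψ) (zero_add 0) = _ := hy
  rw [Abelian.Ext.mk₀_comp_mk₀] at hy
  have := Abelian.Ext.homEquiv₀.symm.injective hy
  exact ⟨ψ.hom, congrArg ModuleCat.Hom.hom this⟩

lemma extZero_one_of_dualMap_surjective (h : Function.Surjective f.dualMap)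
    (hB : extZero R (ModuleCat.of R B) (ModuleCat.of R R) 1) :
    extZero R (ModuleCat.of R C) (ModuleCat.of R R) 1 := by
  rw [extZero_succ_iff] at hB ⊢
  refine subsingleton_of_forall_eq 0 fun x => ?_
  obtain ⟨y, rfl⟩ := Abelian.Ext.contravariant_sequence_exact₃ (shortExact_of_exact hf hfg hg)
    (ModuleCat.of R R) x (hB.elim _ _) (n₀ := 0) rfl
  obtain ⟨φ, rfl⟩ := Abelian.Ext.homEquiv₀.symm.surjective y
  obtain ⟨ψ, hψ⟩ := h φ.hom
  obtain rfl : ModuleCat.ofHom f ≫ ModuleCat.ofHom ψ = φ := by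
    ext1
    exact hψ
  change (Abelian.Ext.comp _ (Abelian.Ext.mk₀ _) _) = 0
  rw [← Abelian.Ext.mk₀_comp_mk₀]
  exact ShortComplex.ShortExact.extClass_comp_assoc _ _

omit hf hfg hg

lemma extZero_congr (e : M ≃ₗ[R] N) (h : extZero R (ModuleCat.of R M) Y (n + 1)) :
    extZero R (ModuleCat.of R N) Y (n + 1) :=
  extZero_middle (f := (0 : PUnit.{u + 1} →ₗ[R] N)) (g := e.symm.toLinearMap)
    (Function.injective_of_subsingleton _)
    (LinearMap.exact_zero_iff_injective PUnit.{u + 1} _ |>.2 e.symm.injective) e.symm.surjective Y n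
    (extZero_of_projective Y n) h

end ExtVanishing

section Gtilde

variable {R : Type u} [CommRing R]
variable {A B C M N : Type u} [AddCommGroup A] [AddCommGroup B] [AddCommGroup C]
  [AddCommGroup M] [AddCommGroup N] [Module R A] [Module R B] [Module R C] [Module R M]
  [Module R N]

lemma memGtilde_iff : MemGtilde R (ModuleCat.of R M) ↔
    Module.IsReflexive R M ∧ IsFPInf R (ModuleCat.of R M) ∧
    IsFPInf R (ModuleCat.of R (Module.Dual R M)) ∧
    (∀ i, extZero R (ModuleCat.of R M) (ModuleCat.of R R) (i + 1)) ∧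
    (∀ i, extZero R (ModuleCat.of R (Module.Dual R M)) (ModuleCat.of R R) (i + 1)) := by
  constructor
  · rintro ⟨⟨-, h₁, h₂, h₃⟩, h₄, h₅⟩
    exact ⟨h₁, h₄, h₅, fun i => h₂ _ i.succ_pos, fun i => h₃ _ i.succ_pos⟩
  · rintro ⟨h₁, h₄, h₅, h₂, h₃⟩
    refine ⟨⟨h₄ 0, h₁, fun i hi => ?_, fun i hi => ?_⟩, h₄, h₅⟩
    · obtain ⟨i, rfl⟩ := Nat.exists_eq_add_of_lt hi
      simpa using h₂ i
    · obtain ⟨i, rfl⟩ := Nat.exists_eq_add_of_lt hi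
      simpa using h₃ i

lemma MemGtilde.congr (e : M ≃ₗ[R] N) (h : MemGtilde R (ModuleCat.of R M)) :
    MemGtilde R (ModuleCat.of R N) := by
  rw [memGtilde_iff] at h ⊢
  obtain ⟨h₁, h₂, h₃, h₄, h₅⟩ := h
  exact ⟨Module.equiv e, h₂.congr e, h₃.congr e.symm.dualMap,
    fun i => extZero_congr _ i e (h₄ i), fun i => extZero_congr _ i e.symm.dualMap (h₅ i)⟩

lemma memGtilde_pi (k : ℕ) : MemGtilde R (ModuleCat.of R (Fin k → R)) :=
  memGtilde_iff.2 ⟨inferInstance, fun n => IsFP.pi n k,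
    IsFPInf.congr (Pi.basisFun R (Fin k)).toDualEquiv fun n => IsFP.pi n k,
    extZero_of_projective _, extZero_of_projective _⟩

lemma dualMap_exact {f : A →ₗ[R] B} {g : B →ₗ[R] C} (hfg : Function.Exact f g)
    (hg : Function.Surjective g) : Function.Exact g.dualMap f.dualMap :=
  LinearMap.exact_lcomp_of_exact_of_surjective _ hfg hg

section ShortExact

variable {f : A →ₗ[R] B} {g : B →ₗ[R] C} (hf : Function.Injective f)
  (hfg : Function.Exact f g) (hg : Function.Surjective g)

include hf hfg hg

lemma MemGtilde.kernel (hB : MemGtilde R (ModuleCat.of R B))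
    (hC : MemGtilde R (ModuleCat.of R C)) : MemGtilde R (ModuleCat.of R A) := by
  rw [memGtilde_iff] at hB hC ⊢
  obtain ⟨b₁, b₂, b₃, b₄, b₅⟩ := hB
  obtain ⟨c₁, c₂, c₃, c₄, c₅⟩ := hC
  have d₁ := LinearMap.dualMap_injective_of_surjective hg
  have d₂ := dualMap_exact hfg hg
  have d₃ := dualMap_surjective_of_extZero hf hfg hg (c₄ 0)
  have dd₁ := LinearMap.dualMap_injective_of_surjective d₃
  have dd₂ := dualMap_exact d₂ d₃
  have hnat : ∀ b, g.dualMap.dualMap (Module.Dual.eval R B b) = Module.Dual.eval R C (g b) :=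
    fun b => rfl
  have hnat' : ∀ a, f.dualMap.dualMap (Module.Dual.eval R A a) = Module.Dual.eval R B (f a) :=
    fun b => rfl
  have dd₃ : Function.Surjective g.dualMap.dualMap := fun z => by
    obtain ⟨c, rfl⟩ := c₁.bijective_dual_eval'.2 z
    obtain ⟨b, rfl⟩ := hg c
    exact ⟨_, hnat b⟩
  refine ⟨⟨?_, fun x => ?_⟩, fun n => (b₂ n).kernel hf hfg hg (c₂ (n + 1)), fun n => ?_,
    fun i => extZero_left hf hfg hg _ _ (b₄ i) (c₄ (i + 1)), fun i => ?_⟩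
  · refine Function.Injective.of_comp (f := f.dualMap.dualMap) ?_
    exact b₁.bijective_dual_eval'.1.comp hf
  · obtain ⟨b, hb⟩ := b₁.bijective_dual_eval'.2 (f.dualMap.dualMap x)
    have hgb : g b = 0 := by
      apply c₁.bijective_dual_eval'.1
      rw [map_zero, ← hnat, hb, dd₂.apply_apply_eq_zero]
    obtain ⟨a, rfl⟩ := (hfg b).1 hgb
    exact ⟨a, dd₁ hb⟩
  · exact ((c₃ n).cokernel d₁ d₂ d₃ (b₃ (n + 1))).of_succ
  · cases i with
    | zero => exact extZero_one_of_dualMap_surjective d₁ d₂ d₃ dd₃ (b₅ 0)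
    | succ i => exact extZero_right d₁ d₂ d₃ _ _ (c₅ i) (b₅ (i + 1))

end ShortExact

lemma MemGtilde.prod (hM : MemGtilde R (ModuleCat.of R M)) (hN : MemGtilde R (ModuleCat.of R N)) :
    MemGtilde R (ModuleCat.of R (M × N)) := by
  rw [memGtilde_iff] at hM hN ⊢
  obtain ⟨a₁, a₂, a₃, a₄, a₅⟩ := hM
  obtain ⟨c₁, c₂, c₃, c₄, c₅⟩ := hN
  have hf : Function.Injective (LinearMap.inl R M N) := LinearMap.inl_injective
  have hfg : Function.Exact (LinearMap.inl R M N) (LinearMap.snd R M N) := Function.Exact.inl_snd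
  have hg : Function.Surjective (LinearMap.snd R M N) := LinearMap.snd_surjective
  have d₁ := LinearMap.dualMap_injective_of_surjective hg
  have d₂ := dualMap_exact hfg hg
  have d₃ := dualMap_surjective_of_extZero hf hfg hg (c₄ 0)
  exact ⟨inferInstance, fun n => (a₂ n).extension hf hfg hg (c₂ n),
    fun n => (c₃ n).extension d₁ d₂ d₃ (a₃ n),
    fun i => extZero_middle hf hfg hg _ _ (a₄ i) (c₄ i),
    fun i => extZero_middle d₁ d₂ d₃ _ _ (c₅ i) (a₅ i)⟩

lemma GtildeDimLe.congr {n : ℕ} (e : M ≃ₗ[R] N) (h : GtildeDimLe R n (ModuleCat.of R M)) :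
    GtildeDimLe R n (ModuleCat.of R N) := by
  cases n with
  | zero => exact MemGtilde.congr e h
  | succ n =>
    obtain ⟨G, f, hG, hf, hk⟩ := h
    refine ⟨G, e.toLinearMap ∘ₗ f, hG, e.surjective.comp hf, ?_⟩
    rw [LinearEquiv.ker_comp]
    exact hk

lemma GtildeDimLe.of_exact {n : ℕ} {f : A →ₗ[R] B} {g : B →ₗ[R] C}
    (hf : Function.Injective f) (hfg : Function.Exact f g) (hg : Function.Surjective g)
    (hA : GtildeDimLe R n (ModuleCat.of R A)) (hB : MemGtilde R (ModuleCat.of R B)) :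
    GtildeDimLe R (n + 1) (ModuleCat.of R C) :=
  ⟨ModuleCat.of R B, g, hB, hg, hA.congr (equivKerOfExact hf hfg)⟩

lemma GtildeDimLe.prod {n : ℕ} (hM : GtildeDimLe R n (ModuleCat.of R M))
    (hN : MemGtilde R (ModuleCat.of R N)) : GtildeDimLe R n (ModuleCat.of R (M × N)) := by
  cases n with
  | zero => exact MemGtilde.prod hM hN
  | succ n =>
    obtain ⟨G, f, hG, hf, hk⟩ := hM
    refine GtildeDimLe.of_exact
      (f := LinearMap.inl R G N ∘ₗ (LinearMap.ker f).subtype) (g := f.prodMap LinearMap.id)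
      (LinearMap.inl_injective.comp (Submodule.subtype_injective _)) ?_ ?_ hk
      (MemGtilde.prod (M := G) hG hN)
    · rintro ⟨x, y⟩
      simp [Prod.ext_iff, eq_comm]
    · exact hf.prodMap Function.surjective_id

lemma GtildeDimLe.kernel {n : ℕ} {f : A →ₗ[R] B} {g : B →ₗ[R] C} (hf : Function.Injective f)
    (hfg : Function.Exact f g) (hg : Function.Surjective g)
    (hB : GtildeDimLe R n (ModuleCat.of R B)) (hC : MemGtilde R (ModuleCat.of R C)) :
    GtildeDimLe R n (ModuleCat.of R A) := by
  cases n with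
  | zero => exact MemGtilde.kernel hf hfg hg hB hC
  | succ n =>
    obtain ⟨G, p, hG, hp, hk⟩ := hB
    have hL : MemGtilde R (ModuleCat.of R (LinearMap.ker (g ∘ₗ p))) :=
      MemGtilde.kernel (B := G) (Submodule.subtype_injective _)
        (LinearMap.exact_subtype_ker_map (g ∘ₗ p)) (hg.comp hp) hG hC
    let i : LinearMap.ker p →ₗ[R] LinearMap.ker (g ∘ₗ p) :=
      Submodule.inclusion (LinearMap.ker_le_ker_comp p g)
    let j : LinearMap.ker (g ∘ₗ p) →ₗ[R] LinearMap.ker g := p.restrict fun x hx => hx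
    refine GtildeDimLe.congr (equivKerOfExact hf hfg).symm
      (GtildeDimLe.of_exact (f := i) (g := j) (Submodule.inclusion_injective _) ?_ ?_ hk hL)
    · rintro ⟨x, hx⟩
      constructor
      · intro h
        exact ⟨⟨x, congrArg Subtype.val h⟩, rfl⟩
      · rintro ⟨z, hz⟩
        rw [← hz]
        exact Subtype.ext z.2
    · rintro ⟨b, hb⟩
      obtain ⟨x, rfl⟩ := hp b
      exact ⟨⟨x, hb⟩, rfl⟩

/-- The first syzygy with respect to a projective module of `G̃(R)` has smaller dimension. -/
lemma GtildeDimLe.syzygy {n : ℕ} {f : A →ₗ[R] B} {g : B →ₗ[R] C} (hf : Function.Injective f)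
    (hfg : Function.Exact f g) (hg : Function.Surjective g) [Module.Projective R B]
    (hB : MemGtilde R (ModuleCat.of R B)) (hC : GtildeDimLe R (n + 1) (ModuleCat.of R C)) :
    GtildeDimLe R n (ModuleCat.of R A) := by
  obtain ⟨G, p, hG, hp, hk⟩ := hC
  obtain ⟨l, hl⟩ := Module.projective_lifting_property p g hp
  replace hl : ∀ y, p (l y) = g y := fun y => LinearMap.congr_fun hl y
  have hgf : ∀ x, g (f x) = 0 := fun x => hfg.apply_apply_eq_zero x
  let s : LinearMap.ker p × B →ₗ[R] G := (LinearMap.ker p).subtype.coprod l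
  have hs : ∀ x y, s (x, y) = x + l y := fun x y => by simp [s]
  let j : LinearMap.ker s →ₗ[R] LinearMap.ker g :=
    (LinearMap.snd R (LinearMap.ker p) B).restrict fun x hx => by
      obtain ⟨x, y⟩ := x
      simp only [LinearMap.mem_ker, hs] at hx ⊢
      simpa [hl] using congrArg p hx
  have hj : Function.Bijective j := by
    constructor
    · rw [injective_iff_map_eq_zero]
      rintro ⟨⟨a, x⟩, hx⟩ h
      obtain rfl : x = 0 := congrArg Subtype.val h
      simp only [LinearMap.mem_ker, hs, map_zero, add_zero] at hx
      obtain rfl : a = 0 := Subtype.ext hx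
      rfl
    · rintro ⟨x, hx⟩
      exact ⟨⟨(⟨-l x, by simpa [hl] using hx⟩, x), by simp [hs]⟩, rfl⟩
  refine GtildeDimLe.congr ((LinearEquiv.ofBijective j hj).trans (equivKerOfExact hf hfg).symm)
    (GtildeDimLe.kernel (C := G) (Submodule.subtype_injective _) (LinearMap.exact_subtype_ker_map s)
      ?_ (hk.prod hB) hG)
  intro x
  obtain ⟨b, hb⟩ := hg (p x)
  exact ⟨(⟨x - l b, by simp [hl, hb]⟩, b), by rw [hs]; simp⟩

end Gtilde

section GtildeBaseChange

variable {R : Type u} (S : Type u) [CommRing R] [CommRing S] [Algebra R S]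
variable {A B M : Type u} [AddCommGroup A] [AddCommGroup B] [AddCommGroup M]
  [Module R A] [Module R B] [Module R M]

variable (R M) in
/-- The comparison map from the base change of the dual to the dual of the base change. -/
noncomputable def dualComparison :
    S ⊗[R] Module.Dual R M →ₗ[S] Module.Dual S (S ⊗[R] M) :=
  (Module.Dual.baseChange S).liftBaseChange S

@[simp]
lemma dualComparison_tmul_tmul (s t : S) (φ : Module.Dual R M) (m : M) :
    dualComparison R S M (s ⊗ₜ φ) (t ⊗ₜ m) = s * (φ m • t) := by
  simp [dualComparison]

lemma dualComparison_bijective [Module.Flat R S] [Module.FinitePresentation R M] :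
    Function.Bijective (dualComparison R S M) := by
  have h := Module.FinitePresentation.isBaseChange_map (R := R) (M := M) (N := R) S
  let e := h.equiv.trans
    (LinearEquiv.congrRight (M := S ⊗[R] M) (AlgebraTensorModule.rid R S S))
  have he : dualComparison R S M = e.toLinearMap := by
    ext φ m
    simp [e, IsBaseChange.equiv_tmul]
    rfl
  rw [he]
  exact e.bijective

lemma dualComparison_naturality (f : A →ₗ[R] B) :
    dualComparison R S A ∘ₗ f.dualMap.baseChange S =
      (f.baseChange S).dualMap ∘ₗ dualComparison R S B := by
  ext φ m
  simp

lemma dualMap_baseChange_surjective_iff [Module.FaithfullyFlat R S]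
    [Module.FinitePresentation R A] [Module.FinitePresentation R B] (f : A →ₗ[R] B) :
    Function.Surjective (f.baseChange S).dualMap ↔ Function.Surjective f.dualMap := by
  have h := congrArg DFunLike.coe (dualComparison_naturality S f)
  rw [LinearMap.coe_comp, LinearMap.coe_comp] at h
  rw [← Function.Surjective.of_comp_iff _ (dualComparison_bijective S (M := B)).2, ← h,
    Function.Surjective.of_comp_iff' (dualComparison_bijective S (M := A))]
  exact Module.FaithfullyFlat.lTensor_surjective_iff_surjective R S f.dualMap

lemma extZero_baseChange_iff [Module.FaithfullyFlat R S]
    (h : IsFPInf R (ModuleCat.of R M)) (i : ℕ) :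
    extZero S (ModuleCat.of S (S ⊗[R] M)) (ModuleCat.of S S) (i + 1) ↔
      extZero R (ModuleCat.of R M) (ModuleCat.of R R) (i + 1) := by
  induction i generalizing M with
  | zero =>
    obtain ⟨k, g, hg, hK⟩ := h.exists_surjective
    have hf := Submodule.subtype_injective (LinearMap.ker g)
    have hfg := LinearMap.exact_subtype_ker_map g
    obtain ⟨h₁, h₂, h₃⟩ := baseChange_shortExact S hf hfg hg
    have := hK.finitePresentation
    have key := dualMap_baseChange_surjective_iff S (LinearMap.ker g).subtype
    exact ⟨fun H => extZero_one_of_dualMap_surjective hf hfg hg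
        (key.1 (dualMap_surjective_of_extZero h₁ h₂ h₃ H)) (extZero_of_projective _ _),
      fun H => extZero_one_of_dualMap_surjective h₁ h₂ h₃
        (key.2 (dualMap_surjective_of_extZero hf hfg hg H)) (extZero_of_projective _ _)⟩
  | succ i ih =>
    obtain ⟨k, g, hg, hK⟩ := h.exists_surjective
    have hf := Submodule.subtype_injective (LinearMap.ker g)
    have hfg := LinearMap.exact_subtype_ker_map g
    obtain ⟨h₁, h₂, h₃⟩ := baseChange_shortExact S hf hfg hg
    exact ⟨fun H => extZero_right hf hfg hg _ _
        ((ih hK).1 (extZero_left h₁ h₂ h₃ _ _ (extZero_of_projective _ _) H))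
        (extZero_of_projective _ _),
      fun H => extZero_right h₁ h₂ h₃ _ _
        ((ih hK).2 (extZero_left hf hfg hg _ _ (extZero_of_projective _ _) H))
        (extZero_of_projective _ _)⟩

lemma dualComparison_eval :
    dualComparison R S (Module.Dual R M) ∘ₗ (Module.Dual.eval R M).baseChange S =
      (dualComparison R S M).dualMap ∘ₗ Module.Dual.eval S (S ⊗[R] M) := by
  ext m φ
  simp

lemma isReflexive_baseChange_iff [Module.FaithfullyFlat R S]
    [Module.FinitePresentation R M] [Module.FinitePresentation R (Module.Dual R M)] :
    Module.IsReflexive S (S ⊗[R] M) ↔ Module.IsReflexive R M := by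
  have h := congrArg DFunLike.coe (dualComparison_eval (R := R) S (M := M))
  rw [LinearMap.coe_comp, LinearMap.coe_comp] at h
  have hd : Function.Bijective (dualComparison R S M).dualMap :=
    (LinearEquiv.ofBijective _ (dualComparison_bijective S (M := M))).dualMap.bijective
  have key : Function.Bijective (Module.Dual.eval S (S ⊗[R] M)) ↔
      Function.Bijective (Module.Dual.eval R M) := by
    rw [← Function.Bijective.of_comp_iff' hd, ← h,
      Function.Bijective.of_comp_iff' (dualComparison_bijective S (M := Module.Dual R M))]
    exact Module.FaithfullyFlat.lTensor_bijective_iff_bijective R S (Module.Dual.eval R M)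
  exact ⟨fun H => ⟨key.1 H.bijective_dual_eval'⟩, fun H => ⟨key.2 H.bijective_dual_eval'⟩⟩

lemma memGtilde_baseChange_iff [Module.FaithfullyFlat R S] :
    MemGtilde S (ModuleCat.of S (S ⊗[R] M)) ↔ MemGtilde R (ModuleCat.of R M) := by
  rw [memGtilde_iff, memGtilde_iff, isFPInf_baseChange_iff]
  by_cases hM : IsFPInf R (ModuleCat.of R M)
  swap
  · tauto
  have := hM.finitePresentation
  let e := LinearEquiv.ofBijective _ (dualComparison_bijective (R := R) S (M := M))
  have hd : IsFPInf S (ModuleCat.of S (Module.Dual S (S ⊗[R] M))) ↔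
      IsFPInf R (ModuleCat.of R (Module.Dual R M)) := by
    rw [← isFPInf_baseChange_iff (R := R) S]
    exact ⟨fun h => h.congr e.symm, fun h => h.congr e⟩
  rw [hd]
  by_cases hM' : IsFPInf R (ModuleCat.of R (Module.Dual R M))
  swap
  · tauto
  have := hM'.finitePresentation
  rw [isReflexive_baseChange_iff]
  simp_rw [extZero_baseChange_iff S hM, ← extZero_baseChange_iff S hM']
  have he (i : ℕ) : extZero S (ModuleCat.of S (Module.Dual S (S ⊗[R] M))) (ModuleCat.of S S)
      (i + 1) ↔ extZero S (ModuleCat.of S (S ⊗[R] Module.Dual R M)) (ModuleCat.of S S) (i + 1) :=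
    ⟨extZero_congr _ i e.symm, extZero_congr _ i e⟩
  simp_rw [he]

lemma GtildeDimLe.baseChange [Module.FaithfullyFlat R S] {n : ℕ}
    (h : GtildeDimLe R n (ModuleCat.of R M)) : GtildeDimLe S n (ModuleCat.of S (S ⊗[R] M)) := by
  induction n generalizing M with
  | zero => exact (memGtilde_baseChange_iff S).2 h
  | succ n ih =>
    obtain ⟨G, f, hG, hf, hk⟩ := h
    obtain ⟨h₁, h₂, h₃⟩ := baseChange_shortExact S (Submodule.subtype_injective _)
      (LinearMap.exact_subtype_ker_map f) hf
    exact GtildeDimLe.of_exact h₁ h₂ h₃ (ih hk) ((memGtilde_baseChange_iff S (M := G)).2 hG)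

lemma GtildeDimLe.of_baseChange [Module.FaithfullyFlat R S] {n : ℕ}
    (hM : IsFPInf R (ModuleCat.of R M)) (h : GtildeDimLe S n (ModuleCat.of S (S ⊗[R] M))) :
    GtildeDimLe R n (ModuleCat.of R M) := by
  induction n generalizing M with
  | zero => exact (memGtilde_baseChange_iff S).1 h
  | succ n ih =>
    obtain ⟨k, f, hf, hK⟩ := hM.exists_surjective
    obtain ⟨h₁, h₂, h₃⟩ := baseChange_shortExact S (Submodule.subtype_injective _)
      (LinearMap.exact_subtype_ker_map f) hf
    exact ⟨ModuleCat.of R (Fin k → R), f, memGtilde_pi k, hf,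
      ih hK (GtildeDimLe.syzygy h₁ h₂ h₃ ((memGtilde_baseChange_iff S).2 (memGtilde_pi k)) h)⟩

lemma gtildeDimLe_baseChange_iff [Module.FaithfullyFlat R S] {n : ℕ}
    (hM : IsFPInf R (ModuleCat.of R M)) :
    GtildeDimLe S n (ModuleCat.of S (S ⊗[R] M)) ↔ GtildeDimLe R n (ModuleCat.of R M) :=
  ⟨.of_baseChange S hM, .baseChange S⟩

end GtildeBaseChange

end AB

theorem memGtilde_faithfullyFlat_baseChange (R S : Type u) [CommRing R] [CommRing S]
    [Algebra R S] (hS : Module.FaithfullyFlat R S)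
    (M : Type u) [AddCommGroup M] [Module R M] :
    (AB.MemGtilde R (ModuleCat.of R M) ↔
      AB.MemGtilde S (ModuleCat.of S (TensorProduct R S M))) ∧
    (AB.IsFPInf R (ModuleCat.of R M) →
      AB.GtildeDim R (ModuleCat.of R M) =
        AB.GtildeDim S (ModuleCat.of S (TensorProduct R S M))) :=
  ⟨(AB.memGtilde_baseChange_iff S).symm, fun hM => by
    simp only [AB.GtildeDim, AB.gtildeDimLe_baseChange_iff S hM]⟩
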